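/- arXiv:1407.7168 — 4 statements merged into one kernel-verified Lean document; each statement's English description precedes it below -/
import Mathlib

section
/- Let n ≥ 1 and let m₁, …, m_k ∈ ℤⁿ (1 ≤ k ≤ n) be vectors that extend to a ℤ-basis of the lattice ℤⁿ. Let K = {t₁m₁ + ⋯ + t_k m_k : tᵢ ∈ ℝ, tᵢ ≥ 0} be the cone they generate. Let ξ ∈ ℝⁿ satisfy ⟨ξ, mᵢ⟩ < 0 for every i = 1, …, k. Then the family (e^{⟨ξ,x⟩})_{x ∈ K ∩ ℤⁿ} is summable and ∑_{x ∈ K ∩ ℤⁿ} e^{⟨ξ,x⟩} = ∏_{i=1}^{k} 1/(1 − e^{⟨ξ,mᵢ⟩}). -/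
/-- The product of finitely many geometric series, as a sum over exponent vectors. -/
theorem hasSum_prod_geometric {k : ℕ} (r : Fin k → ℝ) (h0 : ∀ i, 0 ≤ r i) (h1 : ∀ i, r i < 1) :
    HasSum (fun c : Fin k → ℕ => ∏ i, r i ^ c i) (∏ i, (1 - r i)⁻¹) := by
  induction k with
  | zero => simp
  | succ k ih =>
    have hhead := hasSum_geometric_of_lt_one (h0 0) (h1 0)
    have htail := ih (fun i => r i.succ) (fun i => h0 _) (fun i => h1 _)
    have hsummable := hhead.summable.mul_of_nonneg htail.summable
      (fun a => pow_nonneg (h0 0) a)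
      (fun c => Finset.prod_nonneg fun i _ => pow_nonneg (h0 _) _)
    have hmul := hhead.mul htail hsummable
    rw [Fin.prod_univ_succ, ← (Fin.consEquiv fun _ : Fin (k + 1) => ℕ).hasSum_iff]
    refine hmul.congr_fun ?_
    intro c
    simp [Fin.prod_univ_succ, Fin.consEquiv]

/-- The real-linear extension of an integer coordinate functional. -/
theorem exists_real_linear_extension {n : ℕ} (f : (Fin n → ℤ) →ₗ[ℤ] ℤ) :
    ∃ φ : (Fin n → ℝ) →ₗ[ℝ] ℝ, ∀ x : Fin n → ℤ, φ (fun j => (x j : ℝ)) = f x := by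
  refine ⟨Fintype.linearCombination ℝ fun j =>
    (f (fun i => if j = i then 1 else 0) : ℝ), fun x => ?_⟩
  rw [LinearMap.pi_apply_eq_sum_univ f x]
  simp [Fintype.linearCombination_apply]

/-- Exponential sum over a nonsingular (unimodular) lattice cone:
if `m 0, …, m (k-1)` extend to a `ℤ`-basis of `ℤⁿ` and `⟨ξ, mᵢ⟩ < 0` for all `i`,
then the family `e^{⟨ξ,x⟩}` over lattice points `x` of the cone `K` generated by
the `mᵢ` is summable, with sum `∏ᵢ 1/(1 − e^{⟨ξ,mᵢ⟩})`. -/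
theorem exp_sum_unimodular_cone
    (n k : ℕ) (hn : 1 ≤ n) (hk1 : 1 ≤ k) (hkn : k ≤ n)
    (m : Fin k → (Fin n → ℤ))
    (hbasis : ∃ b : Module.Basis (Fin n) ℤ (Fin n → ℤ),
      ∀ i : Fin k, b (Fin.castLE hkn i) = m i)
    (K : Set (Fin n → ℝ))
    (hK : K = {x | ∃ t : Fin k → ℝ, (∀ i, 0 ≤ t i) ∧
      x = ∑ i, t i • (fun j => (m i j : ℝ))})
    (ξ : Fin n → ℝ)
    (hξ : ∀ i : Fin k, (∑ j, ξ j * (m i j : ℝ)) < 0) :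
    Summable (fun x : {x : Fin n → ℤ // (fun j => (x j : ℝ)) ∈ K} =>
      Real.exp (∑ j, ξ j * ((x : Fin n → ℤ) j : ℝ))) ∧
    (∑' x : {x : Fin n → ℤ // (fun j => (x j : ℝ)) ∈ K},
      Real.exp (∑ j, ξ j * ((x : Fin n → ℤ) j : ℝ)))
      = ∏ i : Fin k, 1 / (1 - Real.exp (∑ j, ξ j * (m i j : ℝ))) := by
  obtain ⟨b, hb⟩ := hbasis
  have hcoord : ∀ i l : Fin k, b.coord (Fin.castLE hkn i) (m l) = if l = i then 1 else 0 := by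
    intro i l
    rw [← hb l, Module.Basis.coord_apply, Module.Basis.repr_self, Finsupp.single_apply]
    simp [Fin.ext_iff]
  have hcast : ∀ c : Fin k → ℕ, (fun j => ((∑ i, c i • m i) j : ℝ)) =
      ∑ i, (c i : ℝ) • (fun j => (m i j : ℝ)) := by
    intro c
    ext j
    simp
  let g : (Fin k → ℕ) → {x : Fin n → ℤ // (fun j => (x j : ℝ)) ∈ K} := fun c =>
    ⟨∑ i, c i • m i, by
      rw [hK]
      exact ⟨fun i => c i, fun i => Nat.cast_nonneg _, hcast c⟩⟩
  have hinj : Function.Injective g := by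
    intro c d hcd
    ext i
    have h := congrArg (fun x => b.coord (Fin.castLE hkn i) x.1) hcd
    simp only [g, map_sum, map_nsmul, hcoord] at h
    simpa using h
  have hsurj : Function.Surjective g := by
    rintro ⟨x, hx⟩
    have hx' := hx
    rw [hK] at hx'
    obtain ⟨t, ht, hxt⟩ := hx'
    have hcoe : ∀ i, t i = (b.coord (Fin.castLE hkn i) x : ℝ) := by
      intro i
      obtain ⟨φ, hφ⟩ := exists_real_linear_extension (b.coord (Fin.castLE hkn i))
      rw [← hφ x, hxt]
      simp only [map_sum, map_smul, hφ, hcoord]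
      simp
    have hnat : ∀ i, ∃ c : ℕ, t i = c := by
      intro i
      have h : 0 ≤ b.coord (Fin.castLE hkn i) x := by
        exact_mod_cast (hcoe i) ▸ ht i
      obtain ⟨c, hc⟩ := Int.eq_ofNat_of_zero_le h
      exact ⟨c, by rw [hcoe i, hc]; simp⟩
    choose c hc using hnat
    refine ⟨c, Subtype.ext ?_⟩
    ext j
    have h := congrFun (hcast c) j
    simp only [← hc, ← hxt] at h
    exact_mod_cast h
  have hsum : HasSum (fun x : {x : Fin n → ℤ // (fun j => (x j : ℝ)) ∈ K} =>
      Real.exp (∑ j, ξ j * ((x : Fin n → ℤ) j : ℝ)))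
      (∏ i : Fin k, 1 / (1 - Real.exp (∑ j, ξ j * (m i j : ℝ)))) := by
    rw [← (Equiv.ofBijective g ⟨hinj, hsurj⟩).hasSum_iff]
    simp only [one_div]
    refine (hasSum_prod_geometric _ (fun i => (Real.exp_pos _).le)
      (fun i => Real.exp_lt_one_iff.2 (hξ i))).congr_fun ?_
    intro c
    have hpair : ∑ j, ξ j * (((g c).1 j : ℤ) : ℝ) = ∑ i, (c i : ℝ) * ∑ j, ξ j * (m i j : ℝ) := by
      simp only [Finset.mul_sum]
      rw [Finset.sum_comm]
      refine Finset.sum_congr rfl fun j _ => ?_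
      rw [show (((g c).1 j : ℤ) : ℝ) = _ from congrFun (hcast c) j]
      simp only [Finset.sum_apply, Pi.smul_apply, smul_eq_mul, Finset.mul_sum]
      exact Finset.sum_congr rfl fun i _ => by ring
    simp only [Function.comp_apply, ← Real.exp_nat_mul, ← Real.exp_sum]
    exact congrArg Real.exp hpair
  exact ⟨hsum.summable, hsum.tsum_eq⟩
end

section
/- Let R be the quotient of the polynomial ring ℚ[x, y][D₀, D₁, D₂] by the ideal generated by the four elements D₀D₁D₂, D₁(D₁ − D₀ − x), D₂(D₂ − D₀ − y), and D₀(2D₀ − D₁ − D₂ + x + y). Then R is a free module over ℚ[x, y], with basis given by the residue classes of the seven monomials 1, D₀, D₁, D₂, D₀D₁, D₀D₂, D₁D₂. -/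
open MvPolynomial

noncomputable section

/-- The base ring `Λ = ℚ[x, y]`. -/
abbrev LambdaP2 : Type := MvPolynomial (Fin 2) ℚ

/-- The polynomial ring `ℚ[x, y][D₀, D₁, D₂]`. -/
abbrev PolyP2 : Type := MvPolynomial (Fin 3) LambdaP2

/-- The variable `Dᵢ`. -/
def DP2 (i : Fin 3) : PolyP2 := X i

/-- The scalars `x` and `y` viewed in `ℚ[x,y][D₀,D₁,D₂]`. -/
def xP2 : PolyP2 := C (X 0)
def yP2 : PolyP2 := C (X 1)

/-- The ideal of relations for the projective plane. -/
def IdealP2 : Ideal PolyP2 :=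
  Ideal.span
    { DP2 0 * DP2 1 * DP2 2,
      DP2 1 * (DP2 1 - DP2 0 - xP2),
      DP2 2 * (DP2 2 - DP2 0 - yP2),
      DP2 0 * (2 * DP2 0 - DP2 1 - DP2 2 + xP2 + yP2) }

/-- The seven monomials `1, D₀, D₁, D₂, D₀D₁, D₀D₂, D₁D₂`. -/
def monsP2 : Fin 7 → PolyP2 :=
  ![1, DP2 0, DP2 1, DP2 2, DP2 0 * DP2 1, DP2 0 * DP2 2, DP2 1 * DP2 2]

/-- The seven monomials `1, d₀, d₁, d₂, d₀d₁, d₀d₂, d₁d₂` in a commutative ring. -/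
def squarefreeMons {A : Type*} [CommRing A] (d : Fin 3 → A) : Fin 7 → A :=
  ![1, d 0, d 1, d 2, d 0 * d 1, d 0 * d 2, d 1 * d 2]

/-- The defining relations of the projective plane, for elements `d₀, d₁, d₂` of an algebra over a
base ring containing the scalars `x` and `y`. -/
structure RelationsP2 {A : Type*} [CommRing A] (x y : A) (d : Fin 3 → A) : Prop where
  prod : d 0 * d 1 * d 2 = 0
  one : d 1 * (d 1 - d 0 - x) = 0
  two : d 2 * (d 2 - d 0 - y) = 0
  zero : d 0 * (2 * d 0 - d 1 - d 2 + x + y) = 0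

/-- The span of the seven monomials is stable under multiplication by each `dᵢ`. -/
theorem RelationsP2.mul_mem_span {L A : Type*} [CommRing L] [Algebra ℚ L] [CommRing A] [Algebra L A]
    {x y : L} {d : Fin 3 → A} (h : RelationsP2 (algebraMap L A x) (algebraMap L A y) d)
    (i : Fin 3) {v : A} (hv : v ∈ Submodule.span L (Set.range (squarefreeMons d))) :
    v * d i ∈ Submodule.span L (Set.range (squarefreeMons d)) := by
  obtain ⟨e, he⟩ : ∃ e : L, 2 * e = 1 :=
    ⟨algebraMap ℚ L (1 / 2), by rw [← map_ofNat (algebraMap ℚ L) 2, ← map_mul]; norm_num⟩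
  have he' : 2 * algebraMap L A e = 1 := by
    rw [← map_ofNat (algebraMap L A) 2, ← map_mul, he, map_one]
  obtain ⟨h₀, h₁, h₂, h₃⟩ := h
  have key : ∀ {w : A} (c : Fin 7 → L), ∑ k, c k • squarefreeMons d k = w →
      w ∈ Submodule.span L (Set.range (squarefreeMons d)) := fun c hc =>
    (Submodule.mem_span_range_iff_exists_fun L).2 ⟨c, hc⟩
  have h00 : d 0 * d 0 = algebraMap L A e * (d 0 * d 1 + d 0 * d 2
      - (algebraMap L A x + algebraMap L A y) * d 0) := by
    linear_combination algebraMap L A e * h₃ - d 0 * d 0 * he'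
  have h11 : d 1 * d 1 = d 0 * d 1 + algebraMap L A x * d 1 := by linear_combination h₁
  have h22 : d 2 * d 2 = d 0 * d 2 + algebraMap L A y * d 2 := by linear_combination h₂
  have h001 : d 0 * d 1 * d 0 = -algebraMap L A y * (d 0 * d 1) := by
    linear_combination d 1 * h₃ + h₀ + d 0 * h₁
  have h002 : d 0 * d 2 * d 0 = -algebraMap L A x * (d 0 * d 2) := by
    linear_combination d 2 * h₃ + h₀ + d 0 * h₂
  induction hv using Submodule.span_induction with
  | zero => simp
  | add u w _ _ hu hw => rw [add_mul]; exact add_mem hu hw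
  | smul a u _ hu => rw [smul_mul_assoc]; exact Submodule.smul_mem _ a hu
  | mem u hu =>
    obtain ⟨k, rfl⟩ := hu
    fin_cases i <;> fin_cases k
    · exact key ![0, 1, 0, 0, 0, 0, 0] (by
        simp [squarefreeMons, Fin.sum_univ_seven, Algebra.smul_def])
    · exact key ![0, -e * (x + y), 0, 0, e, e, 0] (by
        simp [squarefreeMons, Fin.sum_univ_seven, Algebra.smul_def]
        linear_combination -h00)
    · exact key ![0, 0, 0, 0, 1, 0, 0] (by
        simp [squarefreeMons, Fin.sum_univ_seven, Algebra.smul_def]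
        ring)
    · exact key ![0, 0, 0, 0, 0, 1, 0] (by
        simp [squarefreeMons, Fin.sum_univ_seven, Algebra.smul_def]
        ring)
    · exact key ![0, 0, 0, 0, -y, 0, 0] (by
        simp [squarefreeMons, Fin.sum_univ_seven, Algebra.smul_def]
        linear_combination -h001)
    · exact key ![0, 0, 0, 0, 0, -x, 0] (by
        simp [squarefreeMons, Fin.sum_univ_seven, Algebra.smul_def]
        linear_combination -h002)
    · exact key ![0, 0, 0, 0, 0, 0, 0] (by
        simp [squarefreeMons, Fin.sum_univ_seven, Algebra.smul_def]
        linear_combination -h₀)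
    · exact key ![0, 0, 1, 0, 0, 0, 0] (by
        simp [squarefreeMons, Fin.sum_univ_seven, Algebra.smul_def])
    · exact key ![0, 0, 0, 0, 1, 0, 0] (by
        simp [squarefreeMons, Fin.sum_univ_seven, Algebra.smul_def])
    · exact key ![0, 0, x, 0, 1, 0, 0] (by
        simp [squarefreeMons, Fin.sum_univ_seven, Algebra.smul_def]
        linear_combination -h11)
    · exact key ![0, 0, 0, 0, 0, 0, 1] (by
        simp [squarefreeMons, Fin.sum_univ_seven, Algebra.smul_def]
        ring)
    · exact key ![0, 0, 0, 0, x - y, 0, 0] (by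
        simp [squarefreeMons, Fin.sum_univ_seven, Algebra.smul_def]
        linear_combination -(d 0 * h11 + h001))
    · exact key ![0, 0, 0, 0, 0, 0, 0] (by
        simp [squarefreeMons, Fin.sum_univ_seven, Algebra.smul_def]
        linear_combination -h₀)
    · exact key ![0, 0, 0, 0, 0, 0, x] (by
        simp [squarefreeMons, Fin.sum_univ_seven, Algebra.smul_def]
        linear_combination -(d 2 * h11 + h₀))
    · exact key ![0, 0, 0, 1, 0, 0, 0] (by
        simp [squarefreeMons, Fin.sum_univ_seven, Algebra.smul_def])
    · exact key ![0, 0, 0, 0, 0, 1, 0] (by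
        simp [squarefreeMons, Fin.sum_univ_seven, Algebra.smul_def])
    · exact key ![0, 0, 0, 0, 0, 0, 1] (by
        simp [squarefreeMons, Fin.sum_univ_seven, Algebra.smul_def])
    · exact key ![0, 0, 0, y, 0, 1, 0] (by
        simp [squarefreeMons, Fin.sum_univ_seven, Algebra.smul_def]
        linear_combination -h22)
    · exact key ![0, 0, 0, 0, 0, 0, 0] (by
        simp [squarefreeMons, Fin.sum_univ_seven, Algebra.smul_def]
        linear_combination -h₀)
    · exact key ![0, 0, 0, 0, 0, y - x, 0] (by
        simp [squarefreeMons, Fin.sum_univ_seven, Algebra.smul_def]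
        linear_combination -(d 0 * h22 + h002))
    · exact key ![0, 0, 0, 0, 0, 0, y] (by
        simp [squarefreeMons, Fin.sum_univ_seven, Algebra.smul_def]
        linear_combination -(d 1 * h22 + h₀))

/-- The seven monomials span an algebra generated by elements satisfying the relations. -/
theorem RelationsP2.aeval_mem_span {L A : Type*} [CommRing L] [Algebra ℚ L] [CommRing A]
    [Algebra L A] {x y : L} {d : Fin 3 → A}
    (h : RelationsP2 (algebraMap L A x) (algebraMap L A y) d) (p : MvPolynomial (Fin 3) L) :
    aeval d p ∈ Submodule.span L (Set.range (squarefreeMons d)) := by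
  induction p using MvPolynomial.induction_on with
  | C a =>
    rw [aeval_C, Algebra.algebraMap_eq_smul_one]
    exact Submodule.smul_mem _ a (Submodule.subset_span ⟨0, rfl⟩)
  | add p q hp hq => rw [map_add]; exact add_mem hp hq
  | mul_X p i hp => rw [map_mul, aeval_X]; exact h.mul_mem_span i hp

theorem relationsP2_mk :
    RelationsP2 (algebraMap LambdaP2 (PolyP2 ⧸ IdealP2) (X 0))
      (algebraMap LambdaP2 (PolyP2 ⧸ IdealP2) (X 1))
      (fun i => Ideal.Quotient.mk IdealP2 (DP2 i)) := by
  have hmem : ∀ p ∈ ({ DP2 0 * DP2 1 * DP2 2,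
      DP2 1 * (DP2 1 - DP2 0 - xP2),
      DP2 2 * (DP2 2 - DP2 0 - yP2),
      DP2 0 * (2 * DP2 0 - DP2 1 - DP2 2 + xP2 + yP2) } : Set PolyP2),
      Ideal.Quotient.mk IdealP2 p = 0 := fun p hp =>
    Ideal.Quotient.eq_zero_iff_mem.2 (Ideal.subset_span hp)
  constructor
  · exact hmem (DP2 0 * DP2 1 * DP2 2) (by simp)
  · exact hmem (DP2 1 * (DP2 1 - DP2 0 - xP2)) (by simp)
  · exact hmem (DP2 2 * (DP2 2 - DP2 0 - yP2)) (by simp)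
  · exact hmem (DP2 0 * (2 * DP2 0 - DP2 1 - DP2 2 + xP2 + yP2)) (by simp)

theorem mk_monsP2 (i : Fin 7) :
    Ideal.Quotient.mk IdealP2 (monsP2 i) =
      squarefreeMons (fun j => Ideal.Quotient.mk IdealP2 (DP2 j)) i := by
  fin_cases i <;> rfl

theorem span_range_monsP2 :
    ⊤ ≤ Submodule.span LambdaP2 (Set.range fun i => Ideal.Quotient.mk IdealP2 (monsP2 i)) := by
  rintro v -
  obtain ⟨p, rfl⟩ := Ideal.Quotient.mk_surjective v
  have hp : aeval (fun i => Ideal.Quotient.mk IdealP2 (DP2 i)) p = Ideal.Quotient.mk IdealP2 p :=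
    DFunLike.congr_fun (algHom_ext (f := aeval fun i => Ideal.Quotient.mk IdealP2 (DP2 i))
      (g := Ideal.Quotient.mkₐ LambdaP2 IdealP2) fun i => by simp [DP2]) p
  simp only [mk_monsP2]
  rw [← hp]
  exact relationsP2_mk.aeval_mem_span p

/-- A linear relation among the classes of the seven monomials holds at every common zero of the
defining relations. -/
theorem sum_mul_squarefreeMons_eq_zero {c : Fin 7 → LambdaP2}
    (hc : ∑ i, c i • Ideal.Quotient.mk IdealP2 (monsP2 i) = 0) {d : Fin 3 → LambdaP2}
    (hd : RelationsP2 (X 0) (X 1) d) : ∑ i, c i * squarefreeMons d i = 0 := by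
  have hle : IdealP2 ≤ RingHom.ker (aeval (R := LambdaP2) d) := by
    obtain ⟨h₀, h₁, h₂, h₃⟩ := hd
    refine Ideal.span_le.2 ?_
    rintro p (rfl | rfl | rfl | rfl) <;> simpa [DP2, xP2, yP2, -mul_eq_zero]
  have hmem : ∑ i, c i • monsP2 i ∈ IdealP2 := by
    rw [← Ideal.Quotient.eq_zero_iff_mem, map_sum, ← hc]
    rfl
  have h0 : aeval (R := LambdaP2) d (∑ i, c i • monsP2 i) = 0 := hle hmem
  have hm : ∀ i, aeval (R := LambdaP2) d (monsP2 i) = squarefreeMons d i := by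
    intro i
    fin_cases i <;> simp [monsP2, squarefreeMons, DP2]
  simpa [hm] using h0

theorem linearIndependent_monsP2 :
    LinearIndependent LambdaP2 fun i => Ideal.Quotient.mk IdealP2 (monsP2 i) := by
  rw [Fintype.linearIndependent_iff]
  intro c hc
  obtain ⟨e, he⟩ : ∃ e : LambdaP2, 2 * e = 1 :=
    ⟨C (1 / 2), by rw [← map_ofNat (C : ℚ →+* LambdaP2) 2, ← map_mul]; norm_num⟩
  have hx : (X 0 : LambdaP2) ≠ 0 := X_ne_zero 0
  have hy : (X 1 : LambdaP2) ≠ 0 := X_ne_zero 1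
  have hsub : (X 0 - X 1 : LambdaP2) ≠ 0 :=
    sub_ne_zero.2 fun h => zero_ne_one (X_injective h)
  have hadd : (X 0 + X 1 : LambdaP2) ≠ 0 := fun h => by
    simpa using congrArg (eval fun _ => (1 : ℚ)) h
  have he0 : e ≠ 0 := by
    rintro rfl
    simp at he
  have hsum : ∀ d : Fin 3 → LambdaP2, RelationsP2 (X 0) (X 1) d →
      c 0 + c 1 * d 0 + c 2 * d 1 + c 3 * d 2 + c 4 * (d 0 * d 1) + c 5 * (d 0 * d 2)
        + c 6 * (d 1 * d 2) = 0 := fun d hd => by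
    have := sum_mul_squarefreeMons_eq_zero hc hd
    simp only [Fin.sum_univ_seven] at this
    simpa [squarefreeMons] using this
  have c0 : c 0 = 0 := by
    simpa using hsum ![0, 0, 0] (by constructor <;> simp)
  have c2 : c 2 = 0 := by
    simpa [c0, hx] using hsum ![0, X 0, 0] (by constructor <;> simp)
  have c3 : c 3 = 0 := by
    simpa [c0, hy] using hsum ![0, 0, X 1] (by constructor <;> simp)
  have c6 : c 6 = 0 := by
    simpa [c0, c2, c3, hx, hy] using hsum ![0, X 0, X 1] (by constructor <;> simp)
  have c1 : c 1 = 0 := by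
    have := hsum ![-e * (X 0 + X 1), 0, 0] (by
      constructor <;> simp
      right
      linear_combination (-(X 0 + X 1)) * he)
    simpa [c0, he0, hadd] using this
  have c5 : c 5 = 0 := by
    have := hsum ![-X 0, 0, X 1 - X 0] (by constructor <;> simp; ring)
    simpa [c0, c1, c2, c3, c6, hx, sub_ne_zero.2 (sub_ne_zero.1 hsub).symm] using this
  have c4 : c 4 = 0 := by
    have := hsum ![-X 1, X 0 - X 1, 0] (by constructor <;> simp; ring)
    simpa [c0, c1, c2, c3, c6, hy, hsub] using this
  intro i
  fin_cases i <;> assumption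

/-- The quotient `R = ℚ[x,y][D₀,D₁,D₂]/(D₀D₁D₂, D₁(D₁−D₀−x), D₂(D₂−D₀−y),
D₀(2D₀−D₁−D₂+x+y))` is a free `ℚ[x,y]`-module with basis the residue classes of
`1, D₀, D₁, D₂, D₀D₁, D₀D₂, D₁D₂`. -/
theorem cycle_ring_P2_free :
    ∃ b : Module.Basis (Fin 7) LambdaP2 (PolyP2 ⧸ IdealP2),
      ∀ i : Fin 7, b i = Ideal.Quotient.mk IdealP2 (monsP2 i) := by
  exact ⟨Module.Basis.mk linearIndependent_monsP2 span_range_monsP2, fun i => by simp⟩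

end
end

section
/- Let R be the quotient of the polynomial ring ℚ[x][D₁, D₂] by the ideal generated by the three elements D₁D₂, D₁(D₁ − D₂ − x), and D₂(D₂ − D₁ + x). Then R is a free module over ℚ[x], with basis given by the residue classes of 1, D₁, D₂. -/
open MvPolynomial

noncomputable section

/-- The base ring `Λ = ℚ[x]`. -/
abbrev LambdaP1 : Type := MvPolynomial (Fin 1) ℚ

/-- The polynomial ring `ℚ[x][D₁, D₂]`. -/
abbrev PolyP1 : Type := MvPolynomial (Fin 2) LambdaP1

/-- The variables `D₁, D₂` (indexed by `Fin 2`). -/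
def DP1 (i : Fin 2) : PolyP1 := X i

/-- The scalar `x` viewed in `ℚ[x][D₁, D₂]`. -/
def xP1 : PolyP1 := C (X 0)

/-- The ideal of relations for the projective line. -/
def IdealP1 : Ideal PolyP1 :=
  Ideal.span
    { DP1 0 * DP1 1,
      DP1 0 * (DP1 0 - DP1 1 - xP1),
      DP1 1 * (DP1 1 - DP1 0 + xP1) }

/-- The three monomials `1, D₁, D₂`. -/
def monsP1 : Fin 3 → PolyP1 := ![1, DP1 0, DP1 1]

/-- A point `(d₀, d₁)` over `ℚ[x]` satisfying the relations annihilates the ideal. -/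
lemma aeval_eq_zero_of_mem_IdealP1 {d : Fin 2 → LambdaP1} (h : d 0 * d 1 = 0)
    (h₀ : d 0 * (d 0 - d 1 - X 0) = 0) (h₁ : d 1 * (d 1 - d 0 + X 0) = 0)
    {p : PolyP1} (hp : p ∈ IdealP1) : aeval d p = 0 := by
  have hle : IdealP1 ≤ RingHom.ker (aeval d : PolyP1 →ₐ[LambdaP1] LambdaP1) := by
    rw [IdealP1, Ideal.span_le]
    rintro q (rfl | rfl | rfl)
    · simpa [DP1, RingHom.mem_ker] using h
    · simpa [DP1, xP1, RingHom.mem_ker] using h₀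
    · simpa [DP1, xP1, RingHom.mem_ker] using h₁
  exact hle hp

lemma sum_smul_mk_monsP1 (g : Fin 3 → LambdaP1) :
    ∑ i, g i • Ideal.Quotient.mk IdealP1 (monsP1 i) =
      Ideal.Quotient.mk IdealP1 (C (g 0) + C (g 1) * DP1 0 + C (g 2) * DP1 1) := by
  rw [Fin.sum_univ_three]
  change Ideal.Quotient.mk IdealP1 (g 0 • monsP1 0 + g 1 • monsP1 1 + g 2 • monsP1 2) = _
  simp only [monsP1, Matrix.cons_val, smul_eq_C_mul, mul_one]

lemma linearIndependent_mk_monsP1 :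
    LinearIndependent LambdaP1 fun i ↦ Ideal.Quotient.mk IdealP1 (monsP1 i) := by
  rw [Fintype.linearIndependent_iff]
  intro g hg
  have hmem := Ideal.Quotient.eq_zero_iff_mem.1 ((sum_smul_mk_monsP1 g).symm.trans hg)
  have hX : (X 0 : LambdaP1) ≠ 0 := X_ne_zero 0
  have e₀ := aeval_eq_zero_of_mem_IdealP1 (d := ![0, 0]) (by simp) (by simp) (by simp) hmem
  have e₁ := aeval_eq_zero_of_mem_IdealP1 (d := ![X 0, 0]) (by simp) (by simp) (by simp) hmem
  have e₂ := aeval_eq_zero_of_mem_IdealP1 (d := ![0, -X 0]) (by simp) (by simp) (by simp) hmem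
  simp only [DP1, map_add, map_mul, aeval_C, aeval_X, Algebra.algebraMap_self, RingHom.id_apply,
    Matrix.cons_val_zero, Matrix.cons_val_one, mul_zero, add_zero] at e₀ e₁ e₂
  intro i
  fin_cases i
  · exact e₀
  · simpa [e₀, hX] using e₁
  · simpa [e₀, hX] using e₂

/-- Every polynomial is congruent to a `ℚ[x]`-combination of `1, D₁, D₂`. -/
lemma exists_sub_mem_IdealP1 (p : PolyP1) :
    ∃ g : Fin 3 → LambdaP1, p - (C (g 0) + C (g 1) * DP1 0 + C (g 2) * DP1 1) ∈ IdealP1 := by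
  have r : DP1 0 * DP1 1 ∈ IdealP1 := Ideal.subset_span (Or.inl rfl)
  have r₀ : DP1 0 * (DP1 0 - DP1 1 - xP1) ∈ IdealP1 := Ideal.subset_span (Or.inr (Or.inl rfl))
  have r₁ : DP1 1 * (DP1 1 - DP1 0 + xP1) ∈ IdealP1 := Ideal.subset_span (Or.inr (Or.inr rfl))
  induction p using MvPolynomial.induction_on with
  | C a => exact ⟨![a, 0, 0], by simp⟩
  | add p q hp hq =>
    obtain ⟨g, hg⟩ := hp
    obtain ⟨k, hk⟩ := hq
    refine ⟨g + k, ?_⟩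
    convert add_mem hg hk using 1
    simp only [Pi.add_apply, C_add]
    ring
  | mul_X p j hp =>
    obtain ⟨g, hg⟩ := hp
    fin_cases j
    · refine ⟨![0, g 0 + g 1 * X 0, 0], ?_⟩
      convert add_mem (IdealP1.mul_mem_right (DP1 0) hg)
        (add_mem (IdealP1.mul_mem_left (C (g 1)) r₀)
          (IdealP1.mul_mem_left (C (g 1) + C (g 2)) r)) using 1
      simp only [DP1, xP1, Matrix.cons_val, C_add, C_mul, C_0, Fin.zero_eta]
      ring
    · refine ⟨![0, 0, g 0 - g 2 * X 0], ?_⟩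
      convert add_mem (IdealP1.mul_mem_right (DP1 1) hg)
        (add_mem (IdealP1.mul_mem_left (C (g 2)) r₁)
          (IdealP1.mul_mem_left (C (g 1) + C (g 2)) r)) using 1
      simp only [DP1, xP1, Matrix.cons_val, C_sub, C_mul, C_0, Fin.mk_one]
      ring

lemma span_mk_monsP1 :
    Submodule.span LambdaP1 (Set.range fun i ↦ Ideal.Quotient.mk IdealP1 (monsP1 i)) = ⊤ := by
  refine eq_top_iff.2 fun q _ ↦ ?_
  obtain ⟨p, rfl⟩ := Ideal.Quotient.mk_surjective q
  obtain ⟨g, hg⟩ := exists_sub_mem_IdealP1 p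
  exact (Submodule.mem_span_range_iff_exists_fun LambdaP1).2
    ⟨g, (sum_smul_mk_monsP1 g).trans (Ideal.Quotient.eq.2 hg).symm⟩

/-- The quotient `R = ℚ[x][D₁,D₂]/(D₁D₂, D₁(D₁−D₂−x), D₂(D₂−D₁+x))` is a free
`ℚ[x]`-module with basis the residue classes of `1, D₁, D₂`. -/
theorem cycle_ring_P1_free :
    ∃ b : Module.Basis (Fin 3) LambdaP1 (PolyP1 ⧸ IdealP1),
      ∀ i : Fin 3, b i = Ideal.Quotient.mk IdealP1 (monsP1 i) := by
  exact ⟨Module.Basis.mk linearIndependent_mk_monsP1 span_mk_monsP1.ge,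
    fun i ↦ Module.Basis.mk_apply _ _ i⟩

end
end

section
/- Let R be a commutative ring and let D₁, D₂, m, c, L be elements of R satisfying D₁²D₂ = m·D₁D₂ and D₁² = c·D₁D₂ + L·D₁. Then for every integer i ≥ 2, D₁^i = c·(∑_{j=0}^{i−2} m^j L^{i−2−j})·D₁D₂ + L^{i−1}·D₁. -/
/-- The inductive power computation from the proof of Proposition 3.3:
in a commutative ring, the relations `D₁²D₂ = m·D₁D₂` and `D₁² = c·D₁D₂ + L·D₁`
force `D₁^i = c·(∑_{j=0}^{i−2} m^j L^{i−2−j})·D₁D₂ + L^{i−1}·D₁` for all `i ≥ 2`. -/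
theorem power_formula_in_cycle_ring
    {R : Type*} [CommRing R] (D₁ D₂ m c L : R)
    (h1 : D₁ ^ 2 * D₂ = m * (D₁ * D₂))
    (h2 : D₁ ^ 2 = c * (D₁ * D₂) + L * D₁) :
    ∀ i : ℕ, 2 ≤ i →
      D₁ ^ i =
        c * (∑ j ∈ Finset.range (i - 1), m ^ j * L ^ (i - 2 - j)) * (D₁ * D₂)
          + L ^ (i - 1) * D₁ := by
  intro i hi
  obtain ⟨n, rfl⟩ := Nat.exists_eq_add_of_le' hi
  clear hi
  simp only [Nat.add_sub_cancel, show n + 2 - 1 = n + 1 from rfl]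
  induction n with
  | zero => simpa using h2
  | succ n ih =>
    have hsum : ∑ j ∈ Finset.range (n + 1 + 1), m ^ j * L ^ (n + 1 - j) =
        m * ∑ j ∈ Finset.range (n + 1), m ^ j * L ^ (n - j) + L ^ (n + 1) := by
      rw [Finset.sum_range_succ', Finset.mul_sum]
      simp only [Nat.add_sub_add_right, pow_succ' m, mul_assoc, pow_zero, one_mul, Nat.sub_zero]
    rw [hsum, show n + 1 + 2 = n + 2 + 1 from rfl, pow_succ, ih]
    linear_combination (c * ∑ j ∈ Finset.range (n + 1), m ^ j * L ^ (n - j)) * h1 +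
      L ^ (n + 1) * h2
end
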